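/- arXiv:math/0703892 — 2 statements merged into one kernel-verified Lean document; each statement's English description precedes it below -/
import Mathlib

section
/- Let K ⊆ ℝ be a set homeomorphic to the Cantor space {0,1}^ℕ, let (x_m)_{m∈ℕ} be a sequence of pairwise distinct points of ℝ∖K converging to a point L ∈ ℝ with L ∉ K, and set X := K ∪ {x_m : m ∈ ℕ} ∪ {L}, a compact subspace of ℝ. Then, for 𝕂 = ℝ or ℂ: for every n ∈ ℕ there exists an isometric shift on C(X;𝕂) of type I₀ which is non-primitive and n-generated, and there also exists an isometric shift on C(X;𝕂) of type I₀ which is non-primitive and ∞-generated. -/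
open Topology

open Topology

/-- `T` is an isometric shift: an isometry whose range has codimension 1 and with
`⋂_{n≥1} Tⁿ(E) = {0}`. -/
def IsIsometricShift {𝕜 E : Type*} [RCLike 𝕜] [NormedAddCommGroup E] [NormedSpace 𝕜 E]
    (T : E →L[𝕜] E) : Prop :=
  (∀ f, ‖T f‖ = ‖f‖) ∧
    Module.rank 𝕜 (E ⧸ LinearMap.range (T : E →ₗ[𝕜] E)) = 1 ∧
    (⋂ n : ℕ, Set.range ((⇑T)^[n + 1])) = {0}

/-- A witness that `T` is an isometric shift of type I: an isolated point `p`, a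
homeomorphism `φ : X∖{p} ≃ₜ X` and a unimodular weight `a` with `T f x = a x * f (φ x)`. -/
structure TypeIWitness {X : Type*} [TopologicalSpace X] [CompactSpace X]
    {𝕜 : Type*} [RCLike 𝕜] (T : C(X, 𝕜) →L[𝕜] C(X, 𝕜)) where
  p : X
  isolated : IsOpen ({p} : Set X)
  φ : {x : X // x ≠ p} ≃ₜ X
  a : C({x : X // x ≠ p}, 𝕜)
  norm_a : ∀ x, ‖a x‖ = 1
  hT : ∀ (f : C(X, 𝕜)) (x : {x : X // x ≠ p}), T f x.1 = a x * f (φ x)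

/-- `T` is an isometric shift of type I. -/
def IsTypeI {X : Type*} [TopologicalSpace X] [CompactSpace X]
    {𝕜 : Type*} [RCLike 𝕜] (T : C(X, 𝕜) →L[𝕜] C(X, 𝕜)) : Prop :=
  Nonempty (TypeIWitness T)

/-- `T` is an isometric shift of type II. -/
def IsTypeII {X : Type*} [TopologicalSpace X] [CompactSpace X]
    {𝕜 : Type*} [RCLike 𝕜] (T : C(X, 𝕜) →L[𝕜] C(X, 𝕜)) : Prop :=
  ∃ (ψ : C(X, X)) (b : C(X, 𝕜)), Function.Surjective ψ ∧ (∀ x, ‖b x‖ = 1) ∧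
    ∀ (f : C(X, 𝕜)) (x : X), T f x = b x * f (ψ x)

namespace TypeIWitness

variable {X : Type*} [TopologicalSpace X] [CompactSpace X] {𝕜 : Type*} [RCLike 𝕜]
  {T : C(X, 𝕜) →L[𝕜] C(X, 𝕜)}

/-- The sequence `𝐧₁ = p`, `𝐧_{k+1} = φ⁻¹(𝐧_k)` (0-indexed: `nseq 0 = p`). -/
def nseq (w : TypeIWitness T) : ℕ → X
  | 0 => w.p
  | k + 1 => (w.φ.symm (nseq w k)).1

/-- The set `𝒩 = {𝐧_k : k ∈ ℕ}`. -/
def NSet (w : TypeIWitness T) : Set X :=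
  Set.range w.nseq

/-- `T` (with witness `w`) is non-primitive when `𝒩` is not dense. -/
def NonPrimitive (w : TypeIWitness T) : Prop :=
  closure w.NSet ≠ Set.univ

open Classical in
/-- Forward iteration map associated to `φ` (defined arbitrarily at `p`). -/
noncomputable def fwd (w : TypeIWitness T) : X → X :=
  fun x => if h : x = w.p then w.p else w.φ ⟨x, h⟩

/-- Backward iteration map associated to `φ`. -/
def bwd (w : TypeIWitness T) : X → X :=
  fun x => (w.φ.symm x).1

/-- The full orbit `{φ^k(x) : k ∈ ℤ}` of a point `x` (for points outside `cl 𝒩`,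
where all iterates are genuinely defined). -/
def orbit (w : TypeIWitness T) (x : X) : Set X :=
  (Set.range fun k : ℕ => w.fwd^[k] x) ∪ (Set.range fun k : ℕ => w.bwd^[k] x)

/-- There are `n` points of `X ∖ cl 𝒩` whose joint `ℤ`-orbit under `φ` is dense in
`X ∖ cl 𝒩`. -/
def GeneratedBy (w : TypeIWitness T) (n : ℕ) : Prop :=
  ∃ x : Fin n → X, (∀ i, x i ∉ closure w.NSet) ∧
    (closure w.NSet)ᶜ ⊆ closure (⋃ i, w.orbit (x i))

/-- `n` is the least number of points of `X ∖ cl 𝒩` whose joint orbit is dense in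
`X ∖ cl 𝒩`. -/
def IsNGenerated (w : TypeIWitness T) (n : ℕ) : Prop :=
  w.GeneratedBy n ∧ ∀ m < n, ¬w.GeneratedBy m

/-- `T` (with witness `w`) is `∞`-generated. -/
def InftyGenerated (w : TypeIWitness T) : Prop :=
  ∀ n : ℕ, ¬w.GeneratedBy n

end TypeIWitness

section WeightedComposition

variable {X : Type*} [TopologicalSpace X] [CompactSpace X] [T2Space X] {𝕜 : Type*} [RCLike 𝕜]

/-- Splitting off an isolated point `p` from `X` along an injection `ψ` with range `{p}ᶜ`. -/
noncomputable def splitHomeo (p : X) (ψ : C(X, X)) (hψ : Function.Injective ψ)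
    (hr : Set.range ψ = {p}ᶜ) : Unit ⊕ X ≃ₜ X :=
  Continuous.homeoOfEquivCompactToT2
    (f := Equiv.ofBijective (Sum.elim (fun _ => p) ψ) <| by
      have hp : ∀ y, ψ y ≠ p := fun y => by
        have : ψ y ∈ ({p}ᶜ : Set X) := hr ▸ Set.mem_range_self y
        simpa using this
      constructor
      · rintro (_ | a) (_ | b) h
        · rfl
        · exact absurd h.symm (hp b)
        · exact absurd h (hp a)
        · exact congrArg Sum.inr (hψ h)
      · intro x
        by_cases hx : x = p
        · exact ⟨Sum.inl (), hx.symm⟩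
        · have : x ∈ Set.range ψ := by rw [hr]; exact hx
          obtain ⟨y, hy⟩ := this
          exact ⟨Sum.inr y, hy⟩)
    (by
      change Continuous (Sum.elim (fun _ => p) ψ)
      exact continuous_const.sumElim ψ.continuous)

/-- The homeomorphism from `X ∖ {p}` onto `X` inverse to `ψ`. -/
noncomputable def complHomeo (p : X) (ψ : C(X, X)) (hψ : Function.Injective ψ)
    (hr : Set.range ψ = {p}ᶜ) : {x : X // x ≠ p} ≃ₜ X :=
  (Continuous.homeoOfEquivCompactToT2
    (f := Equiv.ofBijective (fun y => (⟨ψ y, by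
        have : ψ y ∈ ({p}ᶜ : Set X) := hr ▸ Set.mem_range_self y
        simpa using this⟩ : {x : X // x ≠ p})) <| by
      constructor
      · intro a b h
        exact hψ (congrArg Subtype.val h)
      · rintro ⟨x, hx⟩
        have : x ∈ Set.range ψ := by rw [hr]; exact hx
        obtain ⟨y, hy⟩ := this
        exact ⟨y, Subtype.ext hy⟩)
    (by
      change Continuous (fun y => (⟨ψ y, _⟩ : {x : X // x ≠ p}))
      exact ψ.continuous.subtype_mk _)).symm

theorem complHomeo_symm_coe (p : X) (ψ : C(X, X)) (hψ : Function.Injective ψ)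
    (hr : Set.range ψ = {p}ᶜ) (y : X) : ((complHomeo p ψ hψ hr).symm y : X) = ψ y := rfl

/-- The operator with `T f (ψ y) = α y * f y` and `T f p = F f`. -/
noncomputable def shiftOp (p : X) (ψ : C(X, X)) (hψ : Function.Injective ψ)
    (hr : Set.range ψ = {p}ᶜ) (α : C(X, 𝕜)) (hα : ∀ x, ‖α x‖ = 1)
    (F : C(X, 𝕜) →ₗ[𝕜] 𝕜) (hF : ∀ f, ‖F f‖ ≤ 1 / 2 * ‖f‖) : C(X, 𝕜) →L[𝕜] C(X, 𝕜) :=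
  LinearMap.mkContinuous
    { toFun := fun f =>
        { toFun := fun x => Sum.elim (fun _ => F f) (fun y => α y * f y)
            ((splitHomeo p ψ hψ hr).symm x)
          continuous_toFun :=
            (continuous_const.sumElim (α.continuous.mul f.continuous)).comp
              (splitHomeo p ψ hψ hr).symm.continuous }
      map_add' := fun f g => by
        ext x
        rcases h : (splitHomeo p ψ hψ hr).symm x with _ | y <;> simp [h, mul_add]
      map_smul' := fun c f => by
        ext x
        rcases h : (splitHomeo p ψ hψ hr).symm x with _ | y <;> simp [h, mul_left_comm] }
    1 (fun f => by
      rw [one_mul]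
      refine (ContinuousMap.norm_le _ (norm_nonneg f)).2 fun x => ?_
      rcases h : (splitHomeo p ψ hψ hr).symm x with _ | y
      · simpa [h] using (hF f).trans (by linarith [norm_nonneg f])
      · simpa [h, hα] using f.norm_coe_le_norm y)

theorem shiftOp_apply_self (p : X) (ψ : C(X, X)) (hψ : Function.Injective ψ)
    (hr : Set.range ψ = {p}ᶜ) (α : C(X, 𝕜)) (hα : ∀ x, ‖α x‖ = 1)
    (F : C(X, 𝕜) →ₗ[𝕜] 𝕜) (hF : ∀ f, ‖F f‖ ≤ 1 / 2 * ‖f‖) (f : C(X, 𝕜)) :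
    shiftOp p ψ hψ hr α hα F hF f p = F f := by
  have : (splitHomeo p ψ hψ hr).symm p = Sum.inl () :=
    (splitHomeo p ψ hψ hr).symm_apply_eq.2 rfl
  change Sum.elim (fun _ => F f) (fun y => α y * f y) ((splitHomeo p ψ hψ hr).symm p) = _
  rw [this]
  rfl

theorem shiftOp_apply_map (p : X) (ψ : C(X, X)) (hψ : Function.Injective ψ)
    (hr : Set.range ψ = {p}ᶜ) (α : C(X, 𝕜)) (hα : ∀ x, ‖α x‖ = 1)
    (F : C(X, 𝕜) →ₗ[𝕜] 𝕜) (hF : ∀ f, ‖F f‖ ≤ 1 / 2 * ‖f‖) (f : C(X, 𝕜)) (y : X) :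
    shiftOp p ψ hψ hr α hα F hF f (ψ y) = α y * f y := by
  have : (splitHomeo p ψ hψ hr).symm (ψ y) = Sum.inr y :=
    (splitHomeo p ψ hψ hr).symm_apply_eq.2 rfl
  change Sum.elim (fun _ => F f) (fun y => α y * f y) ((splitHomeo p ψ hψ hr).symm (ψ y)) = _
  rw [this]
  rfl

theorem isOpen_singleton_of_range_eq_compl (p : X) (ψ : C(X, X))
    (hr : Set.range ψ = {p}ᶜ) : IsOpen ({p} : Set X) := by
  rw [← isClosed_compl_iff, ← hr]
  exact (isCompact_range ψ.continuous).isClosed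

/-- The canonical type I witness of `shiftOp`. -/
noncomputable def shiftWitness (p : X) (ψ : C(X, X)) (hψ : Function.Injective ψ)
    (hr : Set.range ψ = {p}ᶜ) (α : C(X, 𝕜)) (hα : ∀ x, ‖α x‖ = 1)
    (F : C(X, 𝕜) →ₗ[𝕜] 𝕜) (hF : ∀ f, ‖F f‖ ≤ 1 / 2 * ‖f‖) :
    TypeIWitness (shiftOp p ψ hψ hr α hα F hF) where
  p := p
  isolated := isOpen_singleton_of_range_eq_compl p ψ hr
  φ := complHomeo p ψ hψ hr
  a := α.comp ⟨_, (complHomeo p ψ hψ hr).continuous⟩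
  norm_a _ := hα _
  hT f x := by
    obtain ⟨y, rfl⟩ := (complHomeo p ψ hψ hr).symm.surjective x
    rw [complHomeo_symm_coe, shiftOp_apply_map]
    simp

theorem not_isTypeII_shiftOp (p : X) (ψ : C(X, X)) (hψ : Function.Injective ψ)
    (hr : Set.range ψ = {p}ᶜ) (α : C(X, 𝕜)) (hα : ∀ x, ‖α x‖ = 1)
    (F : C(X, 𝕜) →ₗ[𝕜] 𝕜) (hF : ∀ f, ‖F f‖ ≤ 1 / 2 * ‖f‖) :
    ¬IsTypeII (shiftOp p ψ hψ hr α hα F hF) := by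
  rintro ⟨χ, b, -, hb, h⟩
  have h1 := h 1 p
  rw [shiftOp_apply_self] at h1
  have h2 := hF 1
  have h3 : ‖(1 : C(X, 𝕜))‖ ≤ 1 := (ContinuousMap.norm_le _ zero_le_one).2 fun x => by simp
  rw [h1] at h2
  simp only [ContinuousMap.one_apply, mul_one, hb] at h2
  linarith

/-- The left inverse of `shiftOp` when `α` takes values in `{1, -1}`. -/
noncomputable def backOp (ψ : C(X, X)) (α : C(X, 𝕜)) : C(X, 𝕜) →ₗ[𝕜] C(X, 𝕜) where
  toFun g := α * g.comp ψ
  map_add' f g := by ext; simp [mul_add]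
  map_smul' c f := by ext; simp

theorem backOp_apply {X : Type*} [TopologicalSpace X] {𝕜 : Type*} [RCLike 𝕜]
    (ψ : C(X, X)) (α g : C(X, 𝕜)) (y : X) :
    backOp ψ α g y = α y * g (ψ y) := rfl

variable (p : X) (ψ : C(X, X)) (hψ : Function.Injective ψ)
  (hr : Set.range ψ = {p}ᶜ) (α : C(X, 𝕜)) (hα : ∀ x, ‖α x‖ = 1)

theorem backOp_shiftOp (hα2 : ∀ x, α x * α x = 1) (F : C(X, 𝕜) →ₗ[𝕜] 𝕜)
    (hF : ∀ f, ‖F f‖ ≤ 1 / 2 * ‖f‖) (f : C(X, 𝕜)) :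
    backOp ψ α (shiftOp p ψ hψ hr α hα F hF f) = f := by
  ext y
  rw [backOp_apply, shiftOp_apply_map, ← mul_assoc, hα2, one_mul]

theorem shiftOp_backOp (hα2 : ∀ x, α x * α x = 1) (F : C(X, 𝕜) →ₗ[𝕜] 𝕜)
    (hF : ∀ f, ‖F f‖ ≤ 1 / 2 * ‖f‖) {g : C(X, 𝕜)} (hg : g p = F (backOp ψ α g)) :
    shiftOp p ψ hψ hr α hα F hF (backOp ψ α g) = g := by
  ext x
  by_cases hx : x = p
  · rw [hx, shiftOp_apply_self, hg]
  · have : x ∈ Set.range ψ := by rw [hr]; exact hx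
    obtain ⟨y, rfl⟩ := this
    rw [shiftOp_apply_map, backOp_apply, ← mul_assoc, hα2, one_mul]

theorem norm_shiftOp (F : C(X, 𝕜) →ₗ[𝕜] 𝕜)
    (hF : ∀ f, ‖F f‖ ≤ 1 / 2 * ‖f‖) (f : C(X, 𝕜)) : ‖shiftOp p ψ hψ hr α hα F hF f‖ = ‖f‖ := by
  apply le_antisymm
  · refine (ContinuousLinearMap.le_opNorm _ _).trans ?_
    refine mul_le_of_le_one_left (norm_nonneg _) ?_
    exact LinearMap.mkContinuous_norm_le _ zero_le_one _
  · refine (ContinuousMap.norm_le _ (norm_nonneg _)).2 fun y => ?_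
    have := (shiftOp p ψ hψ hr α hα F hF f).norm_coe_le_norm (ψ y)
    rwa [shiftOp_apply_map, norm_mul, hα, one_mul] at this

theorem rank_quotient_range_shiftOp (hα2 : ∀ x, α x * α x = 1) (F : C(X, 𝕜) →ₗ[𝕜] 𝕜)
    (hF : ∀ f, ‖F f‖ ≤ 1 / 2 * ‖f‖) :
    Module.rank 𝕜 (C(X, 𝕜) ⧸ LinearMap.range
      (shiftOp p ψ hψ hr α hα F hF : C(X, 𝕜) →ₗ[𝕜] C(X, 𝕜))) = 1 := by
  classical
  let ℓ : C(X, 𝕜) →ₗ[𝕜] 𝕜 :=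
    { toFun := fun g => g p - F (backOp ψ α g)
      map_add' := fun f g => by simp; ring
      map_smul' := fun c f => by simp [mul_sub] }
  have hker : LinearMap.range (shiftOp p ψ hψ hr α hα F hF : C(X, 𝕜) →ₗ[𝕜] C(X, 𝕜)) =
      LinearMap.ker ℓ := by
    ext g
    constructor
    · rintro ⟨f, rfl⟩
      change shiftOp p ψ hψ hr α hα F hF f p -
        F (backOp ψ α (shiftOp p ψ hψ hr α hα F hF f)) = 0
      rw [backOp_shiftOp p ψ hψ hr α hα hα2 F hF, shiftOp_apply_self, sub_self]
    · intro hg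
      exact ⟨backOp ψ α g, shiftOp_backOp p ψ hψ hr α hα hα2 F hF (sub_eq_zero.1 hg)⟩
  have hcl : IsClopen ({p} : Set X) :=
    ⟨isClosed_singleton, isOpen_singleton_of_range_eq_compl p ψ hr⟩
  let δ : C(X, 𝕜) := ⟨Set.indicator {p} 1, continuous_one.indicator (by simp [hcl.frontier_eq])⟩
  have hδ : ℓ δ = 1 := by
    have : backOp ψ α δ = 0 := by
      ext y
      have hy : ψ y ∈ ({p}ᶜ : Set X) := hr ▸ Set.mem_range_self y
      have : δ (ψ y) = 0 := Set.indicator_of_notMem hy _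
      rw [backOp_apply, this]
      simp
    change δ p - F (backOp ψ α δ) = 1
    rw [this, map_zero, sub_zero]
    exact Set.indicator_of_mem (Set.mem_singleton p) _
  have hsurj : Function.Surjective ℓ := fun c => ⟨c • δ, by rw [map_smul, hδ]; simp⟩
  have h := (ℓ.quotKerEquivOfSurjective hsurj).lift_rank_eq
  rw [Module.rank_self, Cardinal.lift_one] at h
  rw [hker]
  exact Cardinal.lift_eq_one.1 h

/-- Iterated backward images of an element of every `Tⁿ(E)` satisfy the compatibility
condition at `p`. -/
theorem iterate_backOp_apply_of_mem_iInter (hα2 : ∀ x, α x * α x = 1) (F : C(X, 𝕜) →ₗ[𝕜] 𝕜)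
    (hF : ∀ f, ‖F f‖ ≤ 1 / 2 * ‖f‖) {g : C(X, 𝕜)}
    (hg : g ∈ ⋂ n : ℕ, Set.range ((⇑(shiftOp p ψ hψ hr α hα F hF))^[n + 1])) (n : ℕ) :
    ((backOp ψ α)^[n] g) p = F ((backOp ψ α)^[n + 1] g) := by
  obtain ⟨f, rfl⟩ := Set.mem_iInter.1 hg n
  have hl : Function.LeftInverse (backOp ψ α) (shiftOp p ψ hψ hr α hα F hF) :=
    backOp_shiftOp p ψ hψ hr α hα hα2 F hF
  have h1 : (backOp ψ α)^[n] ((shiftOp p ψ hψ hr α hα F hF)^[n + 1] f) =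
      shiftOp p ψ hψ hr α hα F hF f := by
    rw [Function.iterate_succ_apply, hl.iterate n]
  rw [h1, hl.iterate (n + 1) f, shiftOp_apply_self]

theorem isIsometricShift_shiftOp (hα2 : ∀ x, α x * α x = 1) (F : C(X, 𝕜) →ₗ[𝕜] 𝕜)
    (hF : ∀ f, ‖F f‖ ≤ 1 / 2 * ‖f‖)
    (H : ∀ g : C(X, 𝕜),
      (∀ n, ((backOp ψ α)^[n] g) p = F ((backOp ψ α)^[n + 1] g)) → g = 0) :
    IsIsometricShift (shiftOp p ψ hψ hr α hα F hF) := by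
  refine ⟨norm_shiftOp p ψ hψ hr α hα F hF,
    rank_quotient_range_shiftOp p ψ hψ hr α hα hα2 F hF, ?_⟩
  ext g
  constructor
  · exact fun hg => H g (iterate_backOp_apply_of_mem_iInter p ψ hψ hr α hα hα2 F hF hg)
  · rintro rfl
    exact Set.mem_iInter.2 fun n => ⟨0, Function.iterate_fixed (map_zero _) _⟩

end WeightedComposition

section Symbolic

theorem eq_of_abs_two_mul_sq_sub_le {j j' : ℕ}
    (h : |2 * (j : ℤ) ^ 2 - 2 * (j' : ℤ) ^ 2| ≤ (j : ℤ) + j') : j = j' := by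
  obtain ⟨h1, h2⟩ := abs_le.1 h
  rcases lt_trichotomy j j' with hlt | heq | hgt
  · have : (j : ℤ) + 1 ≤ j' := by exact_mod_cast hlt
    nlinarith
  · exact heq
  · have : (j' : ℤ) + 1 ≤ j := by exact_mod_cast hgt
    nlinarith

/-- A point of the full shift whose forward orbit accumulates at every point. -/
theorem exists_forall_mapClusterPt_shift : ∃ σ : ℕ × ℤ → Bool, ∀ τ : ℕ × ℤ → Bool,
    MapClusterPt τ Filter.atTop (fun (k : ℕ) (c : ℕ × ℤ) => σ (c.1, c.2 + k)) := by
  classical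
  let P : ℕ → Finset (ℕ × ℤ) := fun j => (Encodable.decode (Nat.unpair j).1).getD ∅
  let Good : ℕ × ℤ → Prop := fun c => ∃ j : ℕ,
    |c.2 - 2 * (j : ℤ) ^ 2| ≤ (j : ℤ) ∧ (c.1, c.2 - 2 * (j : ℤ) ^ 2) ∈ P j
  refine ⟨fun c => decide (Good c), fun τ => ?_⟩
  rw [mapClusterPt_iff_frequently]
  intro s hs
  rw [Filter.frequently_atTop]
  intro N
  obtain ⟨I, t, ht, hsub⟩ : ∃ (I : Finset (ℕ × ℤ)) (t : ℕ × ℤ → Set Bool),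
      (∀ c, t c ∈ nhds (τ c)) ∧ (I : Set (ℕ × ℤ)).pi t ⊆ s := by
    rw [nhds_pi, Filter.mem_pi'] at hs
    exact hs
  let B : ℕ := I.sup fun c => c.2.natAbs
  let Q : Finset (ℕ × ℤ) := I.filter fun c => τ c = true
  let j : ℕ := Nat.pair (Encodable.encode Q) (max N B)
  have hPj : P j = Q := by simp [P, j]
  have hj : max N B ≤ j := Nat.right_le_pair _ _
  refine ⟨2 * j ^ 2, by nlinarith [le_max_left N B], hsub fun c hc => ?_⟩
  have hcB : |c.2| ≤ (j : ℤ) := by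
    have : c.2.natAbs ≤ B := Finset.le_sup (f := fun c : ℕ × ℤ => c.2.natAbs) hc
    rw [Int.abs_eq_natAbs]
    exact_mod_cast this.trans ((le_max_right N B).trans hj)
  have key : Good (c.1, c.2 + ((2 * j ^ 2 : ℕ) : ℤ)) ↔ τ c = true := by
    constructor
    · rintro ⟨j', h1, h2⟩
      have : j = j' := by
        apply eq_of_abs_two_mul_sq_sub_le
        push_cast at h1
        rw [abs_le] at h1 hcB ⊢
        constructor <;> linarith [h1.1, h1.2, hcB.1, hcB.2]
      subst this
      rw [hPj] at h2
      have h3 : (c.1, c.2 + ((2 * j ^ 2 : ℕ) : ℤ) - 2 * (j : ℤ) ^ 2) = c := by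
        ext <;> simp
      rw [h3] at h2
      exact (Finset.mem_filter.1 h2).2
    · intro h
      have h3 : c.2 + ((2 * j ^ 2 : ℕ) : ℤ) - 2 * (j : ℤ) ^ 2 = c.2 := by simp
      refine ⟨j, ?_, ?_⟩
      · simpa only [h3] using hcB
      · simp only [h3, hPj]
        exact Finset.mem_filter.2 ⟨hc, h⟩
  have : decide (Good (c.1, c.2 + ((2 * j ^ 2 : ℕ) : ℤ))) = τ c := by
    rw [Bool.eq_iff_iff, decide_eq_true_iff, key]
  change decide (Good (c.1, c.2 + ((2 * j ^ 2 : ℕ) : ℤ))) ∈ t c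
  rw [this]
  exact mem_of_mem_nhds (ht c)

/-- The two-sided shift. -/
def shiftMap (y : ℤ → Bool) : ℤ → Bool := fun m => y (m + 1)

theorem continuous_shiftMap : Continuous shiftMap :=
  continuous_pi fun m => continuous_apply (m + 1)

theorem shiftMap_bijective : Function.Bijective shiftMap := by
  refine ⟨fun a b h => ?_, fun y => ⟨fun m => y (m - 1), ?_⟩⟩
  · ext m
    have := congrFun h (m - 1)
    simpa [shiftMap] using this
  · ext m
    simp [shiftMap]

theorem iterate_shiftMap (k : ℕ) (y : ℤ → Bool) (m : ℤ) :
    shiftMap^[k] y m = y (m + k) := by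
  induction k generalizing y with
  | zero => simp
  | succ k ih =>
    rw [Function.iterate_succ_apply, ih, shiftMap]
    push_cast
    ring_nf

/-- The map recording where a sequence changes value. -/
def diffMap (y : ℤ → Bool) : ℤ → Bool := fun m => xor (y m) (y (m + 1))

theorem continuous_diffMap : Continuous diffMap := by
  refine continuous_pi fun m => ?_
  have h : Continuous fun q : Bool × Bool => xor q.1 q.2 := continuous_of_discreteTopology
  have h2 : Continuous fun y : ℤ → Bool => (y m, y (m + 1)) := by fun_prop
  exact h.comp h2

theorem diffMap_not (y : ℤ → Bool) : diffMap (fun m => !y m) = diffMap y := by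
  ext m
  simp [diffMap]

theorem diffMap_surjective : Function.Surjective diffMap := by
  intro y
  let A : ℕ → Bool := fun n => Nat.rec false (fun k b => xor b (y k)) n
  let B : ℕ → Bool := fun n => Nat.rec false (fun k b => xor b (y (Int.negSucc k))) n
  let P : ℤ → Bool := fun n => Int.casesOn n A (fun k => B (k + 1))
  refine ⟨P, ?_⟩
  ext m
  rcases m with k | k | k
  · change xor (A k) (xor (A k) (y k)) = y k
    simp
  · change xor (xor false (y (Int.negSucc 0))) false = y (Int.negSucc 0)
    simp
  · change xor (xor (B (k + 1)) (y (Int.negSucc (k + 1)))) (B (k + 1)) = y (Int.negSucc (k + 1))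
    rcases B (k + 1) <;> simp

end Symbolic

section Model

/-- The sign attached to a bit. -/
def bitSign (𝕜 : Type*) [RCLike 𝕜] (b : Bool) : 𝕜 := if b then -1 else 1

section
variable (𝕜 : Type*) [RCLike 𝕜]

theorem bitSign_mul_self (b : Bool) : bitSign 𝕜 b * bitSign 𝕜 b = 1 := by
  cases b <;> simp [bitSign]

theorem norm_bitSign (b : Bool) : ‖bitSign 𝕜 b‖ = 1 := by
  cases b <;> simp [bitSign]

theorem bitSign_xor (a b : Bool) : bitSign 𝕜 (xor a b) = bitSign 𝕜 a * bitSign 𝕜 b := by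
  cases a <;> cases b <;> simp [bitSign]

theorem bitSign_not (b : Bool) : bitSign 𝕜 (!b) = -bitSign 𝕜 b := by
  cases b <;> simp [bitSign]

theorem continuous_bitSign : Continuous (bitSign 𝕜) := continuous_of_discreteTopology

end

theorem tendsto_natCast_infty :
    Filter.Tendsto ((↑) : ℕ → OnePoint ℕ) Filter.atTop (nhds OnePoint.infty) := by
  have := OnePoint.tendsto_coe_infty (X := ℕ)
  rwa [Filter.coclosedCompact_eq_cocompact, Filter.cocompact_eq_cofinite,
    Nat.cofinite_eq_atTop] at this

/-- The successor map on the one-point compactification of `ℕ`. -/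
noncomputable def succInfty : C(OnePoint ℕ, OnePoint ℕ) :=
  OnePoint.continuousMapMkNat (fun n => ((n + 1 : ℕ) : OnePoint ℕ)) OnePoint.infty
    (tendsto_natCast_infty.comp (Filter.tendsto_add_atTop_nat 1))

theorem succInfty_coe (n : ℕ) : succInfty (n : OnePoint ℕ) = ((n + 1 : ℕ) : OnePoint ℕ) := rfl

theorem succInfty_injective : Function.Injective succInfty := by
  intro a b h
  induction a using OnePoint.rec with
  | infty =>
    induction b using OnePoint.rec with
    | infty => rfl
    | coe n => exact absurd h (OnePoint.infty_ne_coe _)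
  | coe m =>
    induction b using OnePoint.rec with
    | infty => exact absurd h (OnePoint.coe_ne_infty _)
    | coe n =>
      rw [succInfty_coe, succInfty_coe] at h
      rw [Nat.succ_injective (OnePoint.coe_injective h)]

theorem range_succInfty : Set.range succInfty = {((0 : ℕ) : OnePoint ℕ)}ᶜ := by
  ext a
  rw [Set.mem_compl_singleton_iff]
  constructor
  · rintro ⟨b, rfl⟩
    induction b using OnePoint.rec with
    | infty => exact OnePoint.infty_ne_coe _
    | coe n =>
      rw [succInfty_coe]
      exact fun h => Nat.succ_ne_zero n (OnePoint.coe_injective h)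
  · intro h
    induction a using OnePoint.rec with
    | infty => exact ⟨OnePoint.infty, rfl⟩
    | coe n =>
      cases n with
      | zero => exact absurd rfl h
      | succ n => exact ⟨(n : OnePoint ℕ), rfl⟩

variable {X I : Type*} [TopologicalSpace X] [TopologicalSpace I]
  (e : X ≃ₜ (I × (ℤ → Bool)) ⊕ OnePoint ℕ)

/-- The shift on `I × (ℤ → Bool)` together with the successor on `OnePoint ℕ`,
transported to `X`. -/
noncomputable def modelMap : C(X, X) where
  toFun x := e.symm (Sum.map (Prod.map id shiftMap) succInfty (e x))
  continuous_toFun := e.symm.continuous.comp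
    (((continuous_id.prodMap continuous_shiftMap).sumMap succInfty.continuous).comp e.continuous)

theorem modelMap_inl (i : I) (y : ℤ → Bool) :
    modelMap e (e.symm (Sum.inl (i, y))) = e.symm (Sum.inl (i, shiftMap y)) := by
  simp [modelMap]

theorem modelMap_inr (a : OnePoint ℕ) :
    modelMap e (e.symm (Sum.inr a)) = e.symm (Sum.inr (succInfty a)) := by
  simp [modelMap]

theorem modelMap_injective : Function.Injective (modelMap e) := by
  have h : Function.Injective (Sum.map (Prod.map id shiftMap : I × (ℤ → Bool) → _) succInfty) :=
    (Function.injective_id.prodMap shiftMap_bijective.1).sumMap succInfty_injective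
  exact e.symm.injective.comp (h.comp e.injective)

theorem range_modelMap :
    Set.range (modelMap e) = {e.symm (Sum.inr ((0 : ℕ) : OnePoint ℕ))}ᶜ := by
  ext x
  obtain ⟨q, rfl⟩ := e.symm.surjective x
  rw [Set.mem_compl_singleton_iff, e.symm.injective.ne_iff]
  rcases q with ⟨i, y⟩ | a
  · refine iff_of_true ?_ (by simp)
    obtain ⟨y, rfl⟩ := shiftMap_bijective.2 y
    exact ⟨_, modelMap_inl e i y⟩
  · rw [Sum.inr_injective.ne_iff]
    have hr : a ∈ Set.range succInfty ↔ a ≠ ((0 : ℕ) : OnePoint ℕ) := by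
      rw [range_succInfty, Set.mem_compl_singleton_iff]
    rw [← hr]
    constructor
    · rintro ⟨x, hx⟩
      obtain ⟨q, rfl⟩ := e.symm.surjective x
      rcases q with ⟨i, y⟩ | b
      · rw [modelMap_inl, e.symm.injective.eq_iff] at hx
        cases hx
      · rw [modelMap_inr, e.symm.injective.eq_iff] at hx
        exact ⟨b, Sum.inr_injective hx⟩
    · rintro ⟨b, rfl⟩
      exact ⟨_, modelMap_inr e b⟩

variable (𝕜 : Type*) [RCLike 𝕜]

/-- The weight: the sign of the zeroth bit on `I × (ℤ → Bool)` and `1` on `OnePoint ℕ`. -/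
noncomputable def modelWeight : C(X, 𝕜) where
  toFun x := Sum.elim (fun q : I × (ℤ → Bool) => bitSign 𝕜 (q.2 0)) (fun _ => 1) (e x)
  continuous_toFun := by
    have h : Continuous fun q : I × (ℤ → Bool) => bitSign 𝕜 (q.2 0) :=
      (continuous_bitSign 𝕜).comp ((continuous_apply 0).comp continuous_snd)
    exact (h.sumElim continuous_const).comp e.continuous

theorem modelWeight_inl (i : I) (y : ℤ → Bool) :
    modelWeight e 𝕜 (e.symm (Sum.inl (i, y))) = bitSign 𝕜 (y 0) := by
  simp [modelWeight]

theorem modelWeight_inr (a : OnePoint ℕ) :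
    modelWeight e 𝕜 (e.symm (Sum.inr a)) = 1 := by
  simp [modelWeight]

theorem modelWeight_mul_self (x : X) : modelWeight e 𝕜 x * modelWeight e 𝕜 x = 1 := by
  obtain ⟨⟨i, y⟩ | a, rfl⟩ := e.symm.surjective x
  · rw [modelWeight_inl, bitSign_mul_self]
  · rw [modelWeight_inr, one_mul]

theorem norm_modelWeight (x : X) : ‖modelWeight e 𝕜 x‖ = 1 := by
  obtain ⟨⟨i, y⟩ | a, rfl⟩ := e.symm.surjective x
  · rw [modelWeight_inl, norm_bitSign]
  · rw [modelWeight_inr, norm_one]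

variable {𝕜}

theorem iterate_backOp_inl (g : C(X, 𝕜)) (k : ℕ) (i : I) (y : ℤ → Bool) :
    ((backOp (modelMap e) (modelWeight e 𝕜))^[k] g) (e.symm (Sum.inl (i, diffMap y))) =
      bitSign 𝕜 (y 0) * (bitSign 𝕜 (y k) *
        g (e.symm (Sum.inl (i, diffMap fun m => y (m + k))))) := by
  induction k generalizing g with
  | zero => simp [← mul_assoc, bitSign_mul_self]
  | succ k ih =>
    have h1 : shiftMap (diffMap fun m => y (m + k)) = diffMap fun m => y (m + (k + 1 : ℕ)) := by
      ext m
      simp only [shiftMap, diffMap]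
      push_cast
      ring_nf
    have h2 : (diffMap fun m => y (m + k)) 0 = xor (y k) (y (k + 1 : ℕ)) := by
      simp [diffMap, add_comm]
    rw [Function.iterate_succ_apply, ih, backOp_apply, modelWeight_inl, modelMap_inl, h1, h2,
      bitSign_xor, ← mul_assoc (bitSign 𝕜 (y k)), ← mul_assoc (bitSign 𝕜 (y k)),
      bitSign_mul_self, one_mul]

theorem iterate_backOp_inr (g : C(X, 𝕜)) (k : ℕ) :
    ((backOp (modelMap e) (modelWeight e 𝕜))^[k] g)
      (e.symm (Sum.inr ((0 : ℕ) : OnePoint ℕ))) = g (e.symm (Sum.inr (k : OnePoint ℕ))) := by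
  induction k generalizing g with
  | zero => rfl
  | succ k ih =>
    rw [Function.iterate_succ_apply, ih, backOp_apply, modelWeight_inr, modelMap_inr, one_mul,
      succInfty_coe]

theorem iterate_modelMap_inl (k : ℕ) (i : I) (y : ℤ → Bool) :
    (modelMap e)^[k] (e.symm (Sum.inl (i, y))) = e.symm (Sum.inl (i, shiftMap^[k] y)) := by
  induction k generalizing y with
  | zero => rfl
  | succ k ih => rw [Function.iterate_succ_apply, modelMap_inl, ih, Function.iterate_succ_apply]

/-- The `j`-th summand of the functional evaluated along the orbit of `τ`. -/
noncomputable def orbitTerm (u : ℕ → I) (g : C(X, 𝕜)) (τ : ℕ × ℤ → Bool) (j : ℕ) : 𝕜 :=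
  (1 / 4 * (1 / 2) ^ j : 𝕜) *
    (bitSign 𝕜 (τ (j, 0)) * g (e.symm (Sum.inl (u j, diffMap fun m => τ (j, m)))))

theorem continuous_orbitTerm (u : ℕ → I) (g : C(X, 𝕜)) (j : ℕ) :
    Continuous fun τ => orbitTerm e u g τ j := by
  have h : Continuous fun τ : ℕ × ℤ → Bool => diffMap fun m => τ (j, m) :=
    continuous_diffMap.comp (continuous_pi fun m => continuous_apply (j, m))
  have h2 : Continuous fun τ : ℕ × ℤ → Bool => bitSign 𝕜 (τ (j, 0)) :=
    (continuous_bitSign 𝕜).comp (continuous_apply (j, 0))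
  have h3 : Continuous fun τ : ℕ × ℤ → Bool =>
      g (e.symm (Sum.inl (u j, diffMap fun m => τ (j, m)))) :=
    g.continuous.comp (e.symm.continuous.comp
      (continuous_inl.comp (continuous_const.prodMk h)))
  exact continuous_const.mul (h2.mul h3)

variable [CompactSpace X]

theorem norm_orbitTerm_le (u : ℕ → I) (g : C(X, 𝕜)) (τ : ℕ × ℤ → Bool) (j : ℕ) :
    ‖orbitTerm e u g τ j‖ ≤ 1 / 4 * ‖g‖ * (1 / 2) ^ j := by
  rw [orbitTerm, norm_mul, norm_mul (bitSign 𝕜 _), norm_bitSign, one_mul]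
  have h : ‖(1 / 4 * (1 / 2) ^ j : 𝕜)‖ = 1 / 4 * (1 / 2) ^ j := by simp
  rw [h, mul_right_comm]
  gcongr
  exact g.norm_coe_le_norm _

theorem summable_orbitTerm_bound (g : C(X, 𝕜)) :
    Summable fun j : ℕ => 1 / 4 * ‖g‖ * (1 / 2 : ℝ) ^ j :=
  summable_geometric_two.mul_left _

theorem summable_orbitTerm (u : ℕ → I) (g : C(X, 𝕜)) (τ : ℕ × ℤ → Bool) :
    Summable (orbitTerm e u g τ) :=
  (summable_orbitTerm_bound g).of_norm_bounded (norm_orbitTerm_le e u g τ)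

/-- The sum of the orbit terms, as a linear functional of `g`. -/
noncomputable def orbitSum (u : ℕ → I) (τ : ℕ × ℤ → Bool) : C(X, 𝕜) →ₗ[𝕜] 𝕜 where
  toFun g := ∑' j, orbitTerm e u g τ j
  map_add' f g := by
    rw [← (summable_orbitTerm e u f τ).tsum_add (summable_orbitTerm e u g τ)]
    congr 1
    ext j
    simp only [orbitTerm, ContinuousMap.add_apply]
    ring
  map_smul' c f := by
    rw [RingHom.id_apply, smul_eq_mul, ← tsum_mul_left]
    congr 1
    ext j
    simp only [orbitTerm, ContinuousMap.smul_apply, smul_eq_mul]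
    ring

theorem continuous_orbitSum (u : ℕ → I) (g : C(X, 𝕜)) :
    Continuous fun τ => orbitSum e u τ g :=
  continuous_tsum (continuous_orbitTerm e u g) (summable_orbitTerm_bound g)
    fun j τ => norm_orbitTerm_le e u g τ j

theorem norm_orbitSum_le (u : ℕ → I) (τ : ℕ × ℤ → Bool) (g : C(X, 𝕜)) :
    ‖orbitSum e u τ g‖ ≤ 1 / 2 * ‖g‖ := by
  have h := tsum_of_norm_bounded (summable_orbitTerm_bound g).hasSum (norm_orbitTerm_le e u g τ)
  rw [tsum_mul_left, tsum_geometric_two] at h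
  refine h.trans_eq ?_
  ring

theorem orbitSum_iterate_backOp (u : ℕ → I) (τ : ℕ × ℤ → Bool) (g : C(X, 𝕜)) (k : ℕ) :
    orbitSum e u τ ((backOp (modelMap e) (modelWeight e 𝕜))^[k] g) =
      orbitSum e u (fun c => τ (c.1, c.2 + k)) g := by
  refine tsum_congr fun j => ?_
  simp only [orbitTerm]
  rw [iterate_backOp_inl e g k (u j) fun m => τ (j, m), ← mul_assoc (bitSign 𝕜 (τ (j, 0))),
    bitSign_mul_self, one_mul, zero_add]

theorem eq_zero_of_orbitSum_const {u : ℕ → I} {g : C(X, 𝕜)} {ℓ : 𝕜}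
    (h : ∀ τ, orbitSum e u τ g = ℓ) (j : ℕ) (y : ℤ → Bool) :
    g (e.symm (Sum.inl (u j, y))) = 0 := by
  obtain ⟨z, rfl⟩ := diffMap_surjective y
  let τ : ℕ × ℤ → Bool := fun c => z c.2
  let τ' : ℕ × ℤ → Bool := fun c => if c.1 = j then !z c.2 else z c.2
  have h1 : ∑' i, (orbitTerm e u g τ i - orbitTerm e u g τ' i) = 0 := by
    rw [(summable_orbitTerm e u g τ).tsum_sub (summable_orbitTerm e u g τ')]
    change orbitSum e u τ g - orbitSum e u τ' g = 0
    rw [h, h, sub_self]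
  rw [tsum_eq_single j fun i hi => by simp [orbitTerm, τ, τ', hi]] at h1
  have h2 : (diffMap fun m => !z m) = diffMap z := diffMap_not z
  simp only [orbitTerm, τ, τ', if_true, h2, bitSign_not] at h1
  have h3 : bitSign 𝕜 (z 0) ≠ 0 := fun h0 => by
    have := bitSign_mul_self 𝕜 (z 0)
    simp [h0] at this
  have h4 : (1 / 4 * (1 / 2) ^ j : 𝕜) ≠ 0 := by simp
  have h5 : (2 : 𝕜) * ((1 / 4 * (1 / 2) ^ j : 𝕜) * (bitSign 𝕜 (z 0) *
      g (e.symm (Sum.inl (u j, diffMap z))))) = 0 := by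
    rw [← h1]
    ring
  simpa only [mul_eq_zero, h3, h4, two_ne_zero, false_or] using h5

theorem eq_zero_of_forall_iterate_backOp {u : ℕ → I} (hu : DenseRange u)
    {σ : ℕ × ℤ → Bool}
    (hσ : ∀ τ : ℕ × ℤ → Bool,
      MapClusterPt τ Filter.atTop (fun (k : ℕ) (c : ℕ × ℤ) => σ (c.1, c.2 + k)))
    {g : C(X, 𝕜)}
    (hg : ∀ n, ((backOp (modelMap e) (modelWeight e 𝕜))^[n] g)
        (e.symm (Sum.inr ((0 : ℕ) : OnePoint ℕ))) =
      orbitSum e u σ ((backOp (modelMap e) (modelWeight e 𝕜))^[n + 1] g)) : g = 0 := by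
  have hcont : Continuous fun a : OnePoint ℕ => g (e.symm (Sum.inr a)) :=
    g.continuous.comp (e.symm.continuous.comp continuous_inr)
  have hg' : ∀ n : ℕ, g (e.symm (Sum.inr (n : OnePoint ℕ))) =
      orbitSum e u (fun c => σ (c.1, c.2 + (n + 1 : ℕ))) g := fun n => by
    rw [← iterate_backOp_inr, hg, orbitSum_iterate_backOp]
  have hlim : Filter.Tendsto (fun n : ℕ => orbitSum e u (fun c => σ (c.1, c.2 + n)) g)
      Filter.atTop (nhds (g (e.symm (Sum.inr OnePoint.infty)))) := by
    rw [← Filter.tendsto_add_atTop_iff_nat 1]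
    refine Filter.Tendsto.congr hg' ?_
    exact (hcont.tendsto OnePoint.infty).comp tendsto_natCast_infty
  have hconst : ∀ τ, orbitSum e u τ g = g (e.symm (Sum.inr OnePoint.infty)) := fun τ => by
    have hc := (hσ τ).continuousAt_comp (continuous_orbitSum e u g).continuousAt
    exact eq_of_nhds_neBot (ClusterPt.mono hc hlim)
  have hinl : ∀ i y, g (e.symm (Sum.inl (i, y))) = 0 := fun i y => by
    have hc : Continuous fun i : I => g (e.symm (Sum.inl (i, y))) :=
      g.continuous.comp (e.symm.continuous.comp
        (continuous_inl.comp (continuous_id.prodMk continuous_const)))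
    have := hu.equalizer hc continuous_const
      (funext fun j => eq_zero_of_orbitSum_const e hconst j y)
    exact congrFun this i
  have hsum : ∀ τ, orbitSum e u τ g = 0 := fun τ => by
    change ∑' j, orbitTerm e u g τ j = 0
    simp [orbitTerm, hinl]
  ext x
  obtain ⟨⟨i, y⟩ | a, rfl⟩ := e.symm.surjective x
  · exact hinl i y
  · induction a using OnePoint.rec with
    | infty => rw [← hconst fun _ => true, hsum, ContinuousMap.zero_apply]
    | coe n => rw [hg', hsum, ContinuousMap.zero_apply]

end Model

section Generation

theorem fwd_shiftWitness {X : Type*} [TopologicalSpace X] [CompactSpace X] [T2Space X]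
    {𝕜 : Type*} [RCLike 𝕜] (p : X) (ψ : C(X, X)) (hψ : Function.Injective ψ)
    (hr : Set.range ψ = {p}ᶜ) (α : C(X, 𝕜)) (hα : ∀ x, ‖α x‖ = 1)
    (F : C(X, 𝕜) →ₗ[𝕜] 𝕜) (hF : ∀ f, ‖F f‖ ≤ 1 / 2 * ‖f‖) (y : X) :
    (shiftWitness p ψ hψ hr α hα F hF).fwd (ψ y) = y := by
  have hy : ψ y ≠ p := by
    have : ψ y ∈ ({p}ᶜ : Set X) := hr ▸ Set.mem_range_self y
    simpa using this
  have : (shiftWitness p ψ hψ hr α hα F hF).fwd (ψ y) = complHomeo p ψ hψ hr ⟨ψ y, hy⟩ :=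
    dif_neg hy
  rw [this]
  exact (complHomeo p ψ hψ hr).apply_symm_apply y

variable {X I : Type*} [TopologicalSpace X] [TopologicalSpace I]
  [CompactSpace X] (e : X ≃ₜ (I × (ℤ → Bool)) ⊕ OnePoint ℕ) {𝕜 : Type*} [RCLike 𝕜]
  {T : C(X, 𝕜) →L[𝕜] C(X, 𝕜)} {w : TypeIWitness T}

theorem nseq_eq (hp : w.p = e.symm (Sum.inr ((0 : ℕ) : OnePoint ℕ)))
    (hb : w.bwd = modelMap e) (n : ℕ) : w.nseq n = e.symm (Sum.inr (n : OnePoint ℕ)) := by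
  induction n with
  | zero => exact hp
  | succ n ih =>
    change w.bwd (w.nseq n) = _
    rw [hb, ih, modelMap_inr, succInfty_coe]

theorem closure_NSet_eq (hp : w.p = e.symm (Sum.inr ((0 : ℕ) : OnePoint ℕ)))
    (hb : w.bwd = modelMap e) : closure w.NSet = e ⁻¹' Set.range Sum.inr := by
  apply Set.Subset.antisymm
  · refine closure_minimal ?_ (isClosed_range_inr.preimage e.continuous)
    rintro _ ⟨n, rfl⟩
    rw [nseq_eq e hp hb]
    exact ⟨n, by simp⟩
  · rintro x ⟨a, ha⟩
    have hx : x = e.symm (Sum.inr a) := by rw [ha, e.symm_apply_apply]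
    rw [hx]
    refine map_mem_closure (f := fun a : OnePoint ℕ => e.symm (Sum.inr a))
      (s := Set.range ((↑) : ℕ → OnePoint ℕ))
      (e.symm.continuous.comp continuous_inr) (OnePoint.denseRange_coe a) ?_
    rintro _ ⟨n, rfl⟩
    exact ⟨n, nseq_eq e hp hb n⟩

theorem symm_inl_notMem_closure_NSet (hp : w.p = e.symm (Sum.inr ((0 : ℕ) : OnePoint ℕ)))
    (hb : w.bwd = modelMap e) (q : I × (ℤ → Bool)) : e.symm (Sum.inl q) ∉ closure w.NSet := by
  rw [closure_NSet_eq e hp hb]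
  simp

theorem exists_eq_symm_inl (hp : w.p = e.symm (Sum.inr ((0 : ℕ) : OnePoint ℕ)))
    (hb : w.bwd = modelMap e) {x : X} (hx : x ∉ closure w.NSet) :
    ∃ q, x = e.symm (Sum.inl q) := by
  obtain ⟨q | a, rfl⟩ := e.symm.surjective x
  · exact ⟨q, rfl⟩
  · rw [closure_NSet_eq e hp hb] at hx
    simp at hx

theorem exists_eq_of_mem_orbit (hb : w.bwd = modelMap e)
    (hf : ∀ y, w.fwd (modelMap e y) = y) {i : I} {y : ℤ → Bool} {z : X}
    (hz : z ∈ w.orbit (e.symm (Sum.inl (i, y)))) : ∃ y', z = e.symm (Sum.inl (i, y')) := by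
  rcases hz with ⟨k, rfl⟩ | ⟨k, rfl⟩
  · induction k generalizing y with
    | zero => exact ⟨y, rfl⟩
    | succ k ih =>
      obtain ⟨y, rfl⟩ := shiftMap_bijective.2 y
      have h : w.fwd^[k + 1] (e.symm (Sum.inl (i, shiftMap y))) =
          w.fwd^[k] (e.symm (Sum.inl (i, y))) := by
        rw [Function.iterate_succ_apply, ← modelMap_inl, hf]
      simp only [h]
      exact ih
  · exact ⟨shiftMap^[k] y, by simp only [hb, iterate_modelMap_inl]⟩

theorem generatedBy_iff [T1Space I] (hp : w.p = e.symm (Sum.inr ((0 : ℕ) : OnePoint ℕ)))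
    (hb : w.bwd = modelMap e) (hf : ∀ y, w.fwd (modelMap e y) = y) (m : ℕ) :
    w.GeneratedBy m ↔ ∃ f : Fin m → I, Function.Surjective f := by
  constructor
  · rintro ⟨x, hx, hd⟩
    choose q hq using fun j => exists_eq_symm_inl e hp hb (hx j)
    refine ⟨fun j => (q j).1, fun i => ?_⟩
    have hcl : IsClosed (e.symm '' (Sum.inl '' {r | r.1 ∈ Set.range fun j => (q j).1})) := by
      rw [e.symm.isClosed_image]
      refine Topology.IsClosedEmbedding.inl.isClosedMap _ ?_
      exact (Set.finite_range _).isClosed.preimage continuous_fst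
    have hsub : (⋃ j, w.orbit (x j)) ⊆
        e.symm '' (Sum.inl '' {r | r.1 ∈ Set.range fun j => (q j).1}) := by
      refine Set.iUnion_subset fun j z hz => ?_
      rw [hq] at hz
      obtain ⟨y', rfl⟩ := exists_eq_of_mem_orbit e hb hf hz
      exact ⟨Sum.inl ((q j).1, y'), ⟨((q j).1, y'), ⟨j, rfl⟩, rfl⟩, rfl⟩
    have hi := closure_minimal hsub hcl
      (hd (symm_inl_notMem_closure_NSet e hp hb (i, fun _ => true)))
    obtain ⟨_, ⟨r, hr, rfl⟩, h⟩ := hi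
    rw [e.symm.injective.eq_iff, Sum.inl_injective.eq_iff] at h
    rw [h] at hr
    exact hr
  · rintro ⟨f, hfs⟩
    obtain ⟨σ, hσ⟩ := exists_forall_mapClusterPt_shift
    refine ⟨fun j => e.symm (Sum.inl (f j, fun m => σ (0, m))),
      fun j => symm_inl_notMem_closure_NSet e hp hb _, fun x hx => ?_⟩
    obtain ⟨⟨i, y⟩, rfl⟩ := exists_eq_symm_inl e hp hb hx
    obtain ⟨j, rfl⟩ := hfs i
    have hc : Continuous fun τ : ℕ × ℤ → Bool =>
        e.symm (Sum.inl (f j, fun m => τ (0, m))) :=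
      e.symm.continuous.comp (continuous_inl.comp
        (continuous_const.prodMk (continuous_pi fun m => continuous_apply (0, m))))
    have h := (hσ fun c => y c.2).continuousAt_comp hc.continuousAt
    change e.symm (Sum.inl (f j, fun m => y m)) ∈ _
    refine ClusterPt.mem_closure_of_mem h _ ?_
    refine Filter.mem_map.2 (Filter.Eventually.of_forall fun k => ?_)
    refine Set.mem_iUnion.2 ⟨j, Or.inr ⟨k, ?_⟩⟩
    simp only [hb, iterate_modelMap_inl, Function.comp]
    congr 3
    ext m
    exact iterate_shiftMap k _ m

/-- On a compact space homeomorphic to `(I × (ℤ → Bool)) ⊕ OnePoint ℕ` there is a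
non-primitive isometric shift of type I₀ for which the number of generating orbits is
governed by the cardinality of `I`. -/
theorem exists_shift_generatedBy_iff [T2Space X] [T1Space I] [TopologicalSpace.SeparableSpace I]
    [Nonempty I] (e : X ≃ₜ (I × (ℤ → Bool)) ⊕ OnePoint ℕ) (𝕜 : Type*) [RCLike 𝕜] :
    ∃ (T : C(X, 𝕜) →L[𝕜] C(X, 𝕜)) (w : TypeIWitness T),
      IsIsometricShift T ∧ ¬IsTypeII T ∧ w.NonPrimitive ∧
        ∀ m, w.GeneratedBy m ↔ ∃ f : Fin m → I, Function.Surjective f := by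
  obtain ⟨σ, hσ⟩ := exists_forall_mapClusterPt_shift
  let u : ℕ → I := TopologicalSpace.denseSeq I
  let F : C(X, 𝕜) →ₗ[𝕜] 𝕜 := orbitSum e u σ
  have hF := norm_orbitSum_le (𝕜 := 𝕜) e u σ
  let w := shiftWitness _ (modelMap e) (modelMap_injective e) (range_modelMap e)
    (modelWeight e 𝕜) (norm_modelWeight e 𝕜) F hF
  have hp : w.p = e.symm (Sum.inr ((0 : ℕ) : OnePoint ℕ)) := rfl
  have hb : w.bwd = modelMap e := rfl
  refine ⟨_, w, ?_, not_isTypeII_shiftOp _ _ _ _ _ _ _ _, ?_,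
    generatedBy_iff e hp hb (fwd_shiftWitness _ _ _ _ _ _ _ _)⟩
  · exact isIsometricShift_shiftOp _ _ _ _ _ _ (modelWeight_mul_self e 𝕜) _ _
      fun g hg => eq_zero_of_forall_iterate_backOp e (TopologicalSpace.denseRange_denseSeq I) hσ hg
  · intro h
    obtain ⟨i⟩ := ‹Nonempty I›
    exact symm_inl_notMem_closure_NSet e hp hb (i, fun _ => true) (h ▸ Set.mem_univ _)

end Generation

section CantorSpace

/-- Two disjoint copies of `{0,1}^ℕ` form a space homeomorphic to `{0,1}^ℕ`. -/
noncomputable def cantorSumCantor : ((ℕ → Bool) ⊕ (ℕ → Bool)) ≃ₜ (ℕ → Bool) :=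
  let eN : Unit ⊕ ℕ ≃ ℕ := (Equiv.sumComm _ _).trans Equiv.natSumPUnitEquivNat
  let e1 : (ℕ → Bool) ≃ₜ (Unit ⊕ ℕ → Bool) :=
    (Homeomorph.piCongrLeft (Y := fun _ => Bool) eN).symm
  let e2 : (ℕ → Bool) ≃ₜ Bool × (ℕ → Bool) :=
    e1.trans (Homeomorph.sumArrowHomeomorphProdArrow.trans
      ((Homeomorph.funUnique Unit Bool).prodCongr (Homeomorph.refl _)))
  let e3 : Bool × (ℕ → Bool) ≃ₜ (Unit ⊕ Unit) × (ℕ → Bool) :=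
    (Equiv.boolEquivPUnitSumPUnit.toHomeomorphOfDiscrete).prodCongr (Homeomorph.refl _)
  ((e2.trans (e3.trans (Homeomorph.sumProdDistrib.trans
    ((Homeomorph.uniqueProd _ _).sumCongr (Homeomorph.uniqueProd _ _)))))).symm

theorem nonempty_finProdCantor (n : ℕ) :
    Nonempty (Fin (n + 1) × (ℕ → Bool) ≃ₜ (ℕ → Bool)) := by
  induction n with
  | zero => exact ⟨Homeomorph.uniqueProd (Fin 1) _⟩
  | succ n ih =>
    obtain ⟨h⟩ := ih
    let e1 : Fin (n + 1 + 1) ≃ₜ Fin (n + 1) ⊕ Fin 1 :=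
      finSumFinEquiv.symm.toHomeomorphOfDiscrete
    exact ⟨(e1.prodCongr (Homeomorph.refl _)).trans (Homeomorph.sumProdDistrib.trans
      ((h.sumCongr (Homeomorph.uniqueProd _ _)).trans cantorSumCantor))⟩

/-- The two-sided sequence space is homeomorphic to the one-sided one. -/
noncomputable def biCantorHomeo : (ℤ → Bool) ≃ₜ (ℕ → Bool) :=
  Homeomorph.piCongrLeft (Y := fun _ => Bool) (Denumerable.eqv ℤ)

theorem nonempty_cantor_homeo_fin_prod {n : ℕ} (hn : 0 < n) :
    Nonempty ((ℕ → Bool) ≃ₜ Fin n × (ℤ → Bool)) := by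
  obtain ⟨n, rfl⟩ := Nat.exists_eq_add_one.2 hn
  obtain ⟨h⟩ := nonempty_finProdCantor n
  exact ⟨h.symm.trans ((Homeomorph.refl _).prodCongr biCantorHomeo.symm)⟩

theorem nonempty_cantor_homeo_prod :
    Nonempty ((ℕ → Bool) ≃ₜ (ℕ → Bool) × (ℤ → Bool)) :=
  ⟨((Homeomorph.piCongrLeft (Y := fun _ => Bool) Equiv.natSumNatEquivNat).symm.trans
    Homeomorph.sumArrowHomeomorphProdArrow).trans
      ((Homeomorph.refl _).prodCongr biCantorHomeo.symm)⟩

/-- A sequence converging to `L` can be thinned out so as to avoid `L`. -/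
theorem exists_injective_seq_avoiding {x : ℕ → ℝ} (hinj : Function.Injective x) {L : ℝ}
    (hlim : Filter.Tendsto x Filter.atTop (nhds L)) :
    ∃ x' : ℕ → ℝ, Function.Injective x' ∧ Filter.Tendsto x' Filter.atTop (nhds L) ∧
      L ∉ Set.range x' ∧ Set.range x ∪ {L} = Set.range x' ∪ {L} := by
  by_cases hL : L ∈ Set.range x
  · obtain ⟨m, rfl⟩ := hL
    let s : ℕ → ℕ := fun k => if k < m then k else k + 1
    have hs : Function.Injective s := by
      intro a b h
      simp only [s] at h
      split_ifs at h <;> omega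
    have hsm : ∀ k, s k ≠ m := by
      intro k h
      simp only [s] at h
      split_ifs at h <;> omega
    refine ⟨x ∘ s, hinj.comp hs, hlim.comp hs.nat_tendsto_atTop, ?_, ?_⟩
    · rintro ⟨k, hk⟩
      exact hsm k (hinj hk)
    · apply Set.Subset.antisymm
      · refine Set.union_subset ?_ Set.subset_union_right
        rintro _ ⟨k, rfl⟩
        rcases lt_trichotomy k m with h | rfl | h
        · exact Or.inl ⟨k, by simp [s, h]⟩
        · exact Or.inr rfl
        · refine Or.inl ⟨k - 1, ?_⟩
          have h1 : ¬k - 1 < m := by omega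
          have h2 : k - 1 + 1 = k := by omega
          simp [s, h1, h2]
      · exact Set.union_subset_union_left _ (Set.range_comp_subset_range _ _)
  · exact ⟨x, hinj, hlim, hL, rfl⟩

theorem nonempty_homeo_sum_onePoint {K : Set ℝ} [CompactSpace K] {x : ℕ → ℝ}
    (hinj : Function.Injective x) (hxK : ∀ m, x m ∉ K) {L : ℝ}
    (hlim : Filter.Tendsto x Filter.atTop (nhds L)) (hLK : L ∉ K) :
    Nonempty (↥(K ∪ Set.range x ∪ {L} : Set ℝ) ≃ₜ K ⊕ OnePoint ℕ) := by
  obtain ⟨x', hinj', hlim', hL', heq⟩ := exists_injective_seq_avoiding hinj hlim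
  have hxK' : ∀ m, x' m ∉ K := fun m => by
    have : x' m ∈ Set.range x ∪ {L} := heq ▸ Or.inl ⟨m, rfl⟩
    rcases this with ⟨k, hk⟩ | h
    · exact hk ▸ hxK k
    · rw [Set.mem_singleton_iff.1 h]
      exact hLK
  let c : C(OnePoint ℕ, ℝ) := OnePoint.continuousMapMkNat x' L hlim'
  have hc : ∀ n : ℕ, c n = x' n := fun _ => rfl
  have hcL : c OnePoint.infty = L := rfl
  have hcinj : Function.Injective c := by
    intro a b h
    induction a using OnePoint.rec with
    | infty =>
      induction b using OnePoint.rec with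
      | infty => rfl
      | coe n => exact absurd ⟨n, h.symm⟩ hL'
    | coe m =>
      induction b using OnePoint.rec with
      | infty => exact absurd ⟨m, h⟩ hL'
      | coe n => rw [hinj' h]
  have hcr : Set.range c = Set.range x' ∪ {L} := by
    ext z
    constructor
    · rintro ⟨a, rfl⟩
      induction a using OnePoint.rec with
      | infty => exact Or.inr rfl
      | coe n => exact Or.inl ⟨n, rfl⟩
    · rintro (⟨n, rfl⟩ | h)
      · exact ⟨n, rfl⟩
      · exact ⟨OnePoint.infty, h.symm⟩
  have hcK : ∀ a, c a ∉ K := fun a => by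
    have : c a ∈ Set.range x' ∪ {L} := hcr ▸ Set.mem_range_self a
    rcases this with ⟨n, hn⟩ | h
    · exact hn ▸ hxK' n
    · rw [Set.mem_singleton_iff.1 h]
      exact hLK
  have hset : K ∪ Set.range x ∪ {L} = K ∪ Set.range c := by
    rw [Set.union_assoc, heq, hcr]
  rw [hset]
  let f : K ⊕ OnePoint ℕ → ↥(K ∪ Set.range c : Set ℝ) :=
    Sum.elim (fun z => ⟨z, Or.inl z.2⟩) (fun a => ⟨c a, Or.inr ⟨a, rfl⟩⟩)
  have hf : Function.Bijective f := by
    constructor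
    · rintro (a | a) (b | b) h
      · have h1 : (a : ℝ) = b :=
          congrArg (Subtype.val : ↥(K ∪ Set.range c : Set ℝ) → ℝ) h
        exact congrArg Sum.inl (Subtype.ext h1)
      · have h1 : (a : ℝ) = c b := congrArg Subtype.val h
        exact absurd (h1 ▸ a.2) (hcK b)
      · have h1 : c a = (b : ℝ) := congrArg Subtype.val h
        exact absurd (h1.symm ▸ b.2) (hcK a)
      · have h1 : c a = c b := congrArg Subtype.val h
        exact congrArg Sum.inr (hcinj h1)
    · rintro ⟨z, hz | ⟨a, rfl⟩⟩
      · exact ⟨Sum.inl ⟨z, hz⟩, rfl⟩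
      · exact ⟨Sum.inr a, rfl⟩
  have hcont : Continuous f :=
    (continuous_subtype_val.subtype_mk _).sumElim (c.continuous.subtype_mk _)
  exact ⟨(Continuous.homeoOfEquivCompactToT2 (f := Equiv.ofBijective f hf) hcont).symm⟩

end CantorSpace

/-- Sequence adjoined to a Cantor set in `ℝ`, converging outside of it: for every
`n ∈ ℕ ∪ {∞}` the space `C(X;𝕂)` admits a non-primitive isometric shift of type I₀
which is `n`-generated. -/
theorem stmt12 (K : Set ℝ) (hK : Nonempty (K ≃ₜ (ℕ → Bool)))
    (x : ℕ → ℝ) (hinj : Function.Injective x) (hxK : ∀ m, x m ∉ K)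
    (L : ℝ) (hlim : Filter.Tendsto x Filter.atTop (nhds L)) (hLK : L ∉ K) :
    ∃ _ : CompactSpace ↥(K ∪ Set.range x ∪ {L} : Set ℝ),
      ∀ (𝕂 : Type) [RCLike 𝕂],
        (∀ n : ℕ, 0 < n →
          ∃ (T : C(↥(K ∪ Set.range x ∪ {L} : Set ℝ), 𝕂) →L[𝕂]
                C(↥(K ∪ Set.range x ∪ {L} : Set ℝ), 𝕂))
            (w : TypeIWitness T),
            IsIsometricShift T ∧ ¬IsTypeII T ∧ w.NonPrimitive ∧ w.IsNGenerated n) ∧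
        ∃ (T : C(↥(K ∪ Set.range x ∪ {L} : Set ℝ), 𝕂) →L[𝕂]
              C(↥(K ∪ Set.range x ∪ {L} : Set ℝ), 𝕂))
          (w : TypeIWitness T),
          IsIsometricShift T ∧ ¬IsTypeII T ∧ w.NonPrimitive ∧ w.InftyGenerated := by
  obtain ⟨hC⟩ := hK
  have : CompactSpace K := hC.symm.compactSpace
  obtain ⟨h0⟩ := nonempty_homeo_sum_onePoint hinj hxK hlim hLK
  have hX : CompactSpace ↥(K ∪ Set.range x ∪ {L} : Set ℝ) := h0.symm.compactSpace
  have h1 := h0.trans (hC.sumCongr (Homeomorph.refl _))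
  refine ⟨hX, fun 𝕂 _ => ⟨fun n hn => ?_, ?_⟩⟩
  · obtain ⟨h2⟩ := nonempty_cantor_homeo_fin_prod hn
    have : Nonempty (Fin n) := ⟨⟨0, hn⟩⟩
    obtain ⟨T, w, hT, hII, hP, hG⟩ :=
      exists_shift_generatedBy_iff (h1.trans (h2.sumCongr (Homeomorph.refl _))) 𝕂
    refine ⟨T, w, hT, hII, hP, (hG n).2 ⟨id, Function.surjective_id⟩, fun m hm h => ?_⟩
    obtain ⟨f, hf⟩ := (hG m).1 h
    have := Fintype.card_le_of_surjective f hf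
    simp only [Fintype.card_fin] at this
    omega
  · obtain ⟨h2⟩ := nonempty_cantor_homeo_prod
    obtain ⟨T, w, hT, hII, hP, hG⟩ :=
      exists_shift_generatedBy_iff (h1.trans (h2.sumCongr (Homeomorph.refl _))) 𝕂
    refine ⟨T, w, hT, hII, hP, fun m h => ?_⟩
    obtain ⟨f, hf⟩ := (hG m).1 h
    have := Finite.of_surjective f hf
    exact not_finite (ℕ → Bool)
end

section
/- Let K ⊆ ℝ be a set homeomorphic to the Cantor space {0,1}^ℕ, let L ∈ K, let (x_m)_{m∈ℕ} be a sequence of pairwise distinct points of ℝ∖K converging to L, and set X := K ∪ {x_m : m ∈ ℕ}, a compact subspace of ℝ. Then, for 𝕂 = ℝ or ℂ, there exists an isometric shift T on C(X;𝕂) which is of type I with weight a ≡ 1 (i.e., there are an isolated point p ∈ X and a homeomorphism φ from X∖{p} onto X with (Tf)(x) = f(φ(x)) for all f and all x ≠ p) and which is not of type II. -/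
open Topology

open Topology

open Filter Set

section Construction

variable {X : Type*} [TopologicalSpace X] [CompactSpace X]

/-- A continuous injection `ψ : X → X` missing exactly the point `p` extends to a homeomorphism
`X ⊕ Unit ≃ₜ X`. -/
theorem exists_homeomorph_sum_unit [T2Space X] {ψ : X → X} (hψ : Continuous ψ)
    (hinj : Function.Injective ψ)
    {p : X} (hp : range ψ = {p}ᶜ) :
    ∃ q : X ⊕ Unit ≃ₜ X, (∀ y, q (Sum.inl y) = ψ y) ∧ q (Sum.inr ()) = p := by
  have hne : ∀ y, ψ y ≠ p := fun y => by
    have : ψ y ∈ range ψ := mem_range_self y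
    rwa [hp] at this
  have hbij : Function.Bijective (Sum.elim ψ (fun _ : Unit => p)) := by
    refine ⟨hinj.sumElim (fun _ _ _ => rfl) (fun y _ => hne y), fun y => ?_⟩
    by_cases h : y = p
    · exact ⟨Sum.inr (), h.symm⟩
    · have : y ∈ range ψ := by rw [hp]; exact h
      obtain ⟨w, rfl⟩ := this
      exact ⟨Sum.inl w, rfl⟩
  have hc : Continuous (Equiv.ofBijective _ hbij) := hψ.sumElim continuous_const
  exact ⟨hc.homeoOfEquivCompactToT2, fun _ => rfl, rfl⟩

/-- The operator sending `f` to the function equal to `f ∘ ψ⁻¹` on the range of `ψ` and to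
`f z / 2` at the point `p` missed by `ψ`, where `q` glues `ψ` and `p`. -/
noncomputable def halfWeightShift (𝕜 : Type*) [RCLike 𝕜] (q : X ⊕ Unit ≃ₜ X) (z : X) :
    C(X, 𝕜) →L[𝕜] C(X, 𝕜) :=
  LinearMap.mkContinuous
    { toFun := fun f =>
        ⟨fun y => Sum.elim f (fun _ => 2⁻¹ * f z) (q.symm y), by fun_prop⟩
      map_add' := fun f g => by
        ext y
        rcases h : q.symm y with w | w <;> simp [h, mul_add]
      map_smul' := fun c f => by
        ext y
        rcases h : q.symm y with w | w <;> simp [h, mul_left_comm] }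
    1 fun f => by
      rw [one_mul]
      refine (ContinuousMap.norm_le _ (norm_nonneg f)).2 fun y => ?_
      rcases h : q.symm y with w | w
      · simpa [h] using f.norm_coe_le_norm w
      · have h1 := f.norm_coe_le_norm z
        have h2 := norm_nonneg (f z)
        simp only [LinearMap.coe_mk, AddHom.coe_mk, ContinuousMap.coe_mk, h, Sum.elim_inr,
          norm_mul, norm_inv, RCLike.norm_ofNat]
        linarith

variable {𝕜 : Type*} [RCLike 𝕜] (q : X ⊕ Unit ≃ₜ X) (z : X)

theorem halfWeightShift_inl (f : C(X, 𝕜)) (y : X) :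
    halfWeightShift 𝕜 q z f (q (Sum.inl y)) = f y := by
  simp [halfWeightShift]

theorem halfWeightShift_inr (f : C(X, 𝕜)) :
    halfWeightShift 𝕜 q z f (q (Sum.inr ())) = 2⁻¹ * f z := by
  simp [halfWeightShift]

theorem halfWeightShift_iterate (f : C(X, 𝕜)) (y : X) (n : ℕ) :
    (halfWeightShift 𝕜 q z)^[n] f ((fun y => q (Sum.inl y))^[n] y) = f y := by
  induction n generalizing y with
  | zero => rfl
  | succ n ih =>
    rw [Function.iterate_succ_apply', Function.iterate_succ_apply', halfWeightShift_inl, ih]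

theorem norm_halfWeightShift (f : C(X, 𝕜)) : ‖halfWeightShift 𝕜 q z f‖ = ‖f‖ := by
  refine le_antisymm ?_ ((ContinuousMap.norm_le _ (norm_nonneg _)).2 fun y => ?_)
  · simpa using (halfWeightShift 𝕜 q z).le_of_opNorm_le (LinearMap.mkContinuous_norm_le _
      zero_le_one _) f
  · rw [← halfWeightShift_inl q z f y]
    exact ContinuousMap.norm_coe_le_norm _ _

theorem rank_quotient_range_halfWeightShift :
    Module.rank 𝕜 (C(X, 𝕜) ⧸ LinearMap.range
      (halfWeightShift 𝕜 q z : C(X, 𝕜) →ₗ[𝕜] C(X, 𝕜))) = 1 := by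
  let l : C(X, 𝕜) →ₗ[𝕜] 𝕜 :=
    { toFun := fun g => g (q (Sum.inr ())) - 2⁻¹ * g (q (Sum.inl z))
      map_add' := fun f g => by simp; ring
      map_smul' := fun c f => by simp; ring }
  have hl : Function.Surjective l := fun c => by
    refine ⟨(2 * c) • 1, ?_⟩
    simp only [l, LinearMap.coe_mk, AddHom.coe_mk, ContinuousMap.smul_apply,
      ContinuousMap.one_apply, smul_eq_mul]
    ring
  have hker : LinearMap.range (halfWeightShift 𝕜 q z : C(X, 𝕜) →ₗ[𝕜] C(X, 𝕜)) =
      LinearMap.ker l := by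
    ext g
    simp only [LinearMap.mem_range, LinearMap.mem_ker, ContinuousLinearMap.coe_coe]
    constructor
    · rintro ⟨f, rfl⟩
      simp [l, halfWeightShift_inl, halfWeightShift_inr]
    · intro hg
      refine ⟨⟨fun y => g (q (Sum.inl y)), by fun_prop⟩, ?_⟩
      ext y
      obtain ⟨w | w, rfl⟩ := q.surjective y
      · rw [halfWeightShift_inl]; rfl
      · rw [halfWeightShift_inr]
        exact (sub_eq_zero.1 hg).symm
  rw [hker]
  have := (l.quotKerEquivOfSurjective hl).lift_rank_eq
  simpa using this

/-- The type I structure of `halfWeightShift`. -/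
noncomputable def halfWeightShiftWitness (𝕜 : Type*) [RCLike 𝕜] :
    TypeIWitness (halfWeightShift 𝕜 q z) where
  p := q (Sum.inr ())
  isolated := by
    have h : ({q (Sum.inr ())} : Set X) = q '' range Sum.inr := by
      rw [← range_comp, range_unique]; rfl
    rw [h]
    exact q.isOpenMap _ isOpen_range_inr
  φ :=
    { toFun := fun y => Sum.elim id (fun _ => z) (q.symm y.1)
      invFun := fun y => ⟨q (Sum.inl y), fun h => by simpa using q.injective h⟩
      left_inv := by
        rintro ⟨y, hy⟩
        obtain ⟨w | w, rfl⟩ := q.surjective y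
        · simp
        · exact absurd rfl hy
      right_inv := fun y => by simp
      continuous_toFun := by fun_prop
      continuous_invFun := by fun_prop }
  a := 1
  norm_a := fun _ => by simp
  hT := by
    rintro f ⟨y, hy⟩
    obtain ⟨w | w, rfl⟩ := q.surjective y
    · rw [halfWeightShift_inl]; simp
    · exact absurd rfl hy

theorem not_isTypeII_halfWeightShift : ¬IsTypeII (halfWeightShift 𝕜 q z) := by
  rintro ⟨ψ, b, -, hb, hT⟩
  have h := hT 1 (q (Sum.inr ()))
  rw [halfWeightShift_inr] at h
  have h' := hb (q (Sum.inr ()))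
  simp only [ContinuousMap.one_apply, mul_one] at h
  rw [← h] at h'
  norm_num at h'

theorem isIsometricShift_halfWeightShift {ψ : X → X} (hψ : ∀ y, q (Sum.inl y) = ψ y)
    {A : Set X} {L : X} (hL : L ∈ A) (hz : z ∈ A) (hA : MapsTo ψ A A)
    (hlim : Tendsto (fun n => ψ^[n] (q (Sum.inr ()))) atTop (𝓝 L))
    (hclus : ∀ y ∈ A, MapClusterPt y atTop (fun n => ψ^[n] z))
    (hcov : ∀ y, y ∈ A ∨ ∃ n, ψ^[n] (q (Sum.inr ())) = y) :
    IsIsometricShift (halfWeightShift 𝕜 q z) := by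
  refine ⟨norm_halfWeightShift q z, rank_quotient_range_halfWeightShift q z, ?_⟩
  obtain rfl : (fun y => q (Sum.inl y)) = ψ := funext hψ
  refine Subset.antisymm (fun g hg => ?_) ?_
  · have key : ∀ n, g ((fun y => q (Sum.inl y))^[n] (q (Sum.inr ()))) =
        2⁻¹ * g ((fun y => q (Sum.inl y))^[n + 1] z) := fun n => by
      obtain ⟨f, rfl⟩ := mem_iInter.1 hg n
      rw [halfWeightShift_iterate, Function.iterate_succ_apply, halfWeightShift_iterate,
        halfWeightShift_inr]
    have hlim' : Tendsto (fun n => g ((fun y => q (Sum.inl y))^[n] z)) atTop (𝓝 (2 * g L)) := by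
      rw [← tendsto_add_atTop_iff_nat 1]
      refine (((g.continuous.tendsto L).comp hlim).const_mul 2).congr fun n => ?_
      rw [Function.comp_apply, key, mul_inv_cancel_left₀ two_ne_zero]
    have hval : ∀ y ∈ A, g y = 2 * g L := fun y hy => by
      have h1 : MapClusterPt (g y) atTop (fun n => g ((fun y => q (Sum.inl y))^[n] z)) :=
        (hclus y hy).continuousAt_comp g.continuous.continuousAt
      exact eq_of_nhds_neBot (h1.neBot.mono (inf_le_inf_left _ hlim'))
    have hgL : g L = 0 := by linear_combination -hval L hL
    have hgA : ∀ y ∈ A, g y = 0 := fun y hy => by rw [hval y hy, hgL, mul_zero]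
    refine ContinuousMap.ext fun y => ?_
    rcases hcov y with hy | ⟨n, rfl⟩
    · exact hgA y hy
    · rw [key, hgA _ (hA.iterate _ hz), mul_zero]; rfl
  · rintro _ rfl
    exact mem_iInter.2 fun n => ⟨0, Function.iterate_fixed (map_zero _) _⟩

end Construction

/-- The points within distance `a` of `2 * a ^ 2` determine `a`. -/
theorem eq_of_abs_sub_two_mul_sq_le {a b : ℕ} {k : ℤ} (ha : |k - 2 * (a : ℤ) ^ 2| ≤ (a : ℤ))
    (hb : |k - 2 * (b : ℤ) ^ 2| ≤ (b : ℤ)) : a = b := by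
  rw [abs_le] at ha hb
  rcases lt_trichotomy a b with h | h | h
  · have h' : (a : ℤ) + 1 ≤ b := by exact_mod_cast h
    nlinarith
  · exact h
  · have h' : (b : ℤ) + 1 ≤ a := by exact_mod_cast h
    nlinarith

/-- The two-sided shift on binary sequences has a point along whose forward orbit every point is
a cluster point. -/
theorem exists_forall_mapClusterPt_shift_s13 :
    ∃ z : ℤ → Bool, ∀ y : ℤ → Bool,
      MapClusterPt y atTop (fun (n : ℕ) (i : ℤ) => z (i + n)) := by
  classical
  let S : ℕ → Finset ℤ := fun a => (Denumerable.eqv (Finset ℤ)).symm a.unpair.1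
  refine ⟨fun k => decide (∃ a : ℕ, |k - 2 * (a : ℤ) ^ 2| ≤ (a : ℤ) ∧ k - 2 * (a : ℤ) ^ 2 ∈ S a),
    fun y => ?_⟩
  let F : ℕ → Finset ℤ := fun m => (Finset.Icc (-(m : ℤ)) m).filter fun i => y i = true
  let u : ℕ → ℕ := fun m => Nat.pair (Denumerable.eqv (Finset ℤ) (F m)) m
  have hu : ∀ m, m ≤ u m := fun m => Nat.right_le_pair _ _
  have hS : ∀ m, S (u m) = F m := fun m => by simp [S, u]
  have hlim : Tendsto (fun m => 2 * u m ^ 2) atTop atTop :=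
    tendsto_atTop_mono (fun m => by have := hu m; simp only [id]; nlinarith) tendsto_id
  refine MapClusterPt.of_comp hlim (Tendsto.mapClusterPt (tendsto_pi_nhds.2 fun i => ?_))
  refine tendsto_const_nhds.congr' ?_
  filter_upwards [eventually_ge_atTop i.natAbs] with m hm
  have him : |i| ≤ (u m : ℤ) := by
    have := hu m
    rw [Int.abs_eq_natAbs]
    omega
  have hiF : i ∈ F m ↔ y i = true := by
    simp only [F, Finset.mem_filter, Finset.mem_Icc, and_iff_right_iff_imp]
    intro _; omega
  rw [eq_comm, Bool.eq_iff_iff]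
  simp only [Function.comp_apply, decide_eq_true_eq]
  rw [← hiF, ← hS]
  push_cast
  constructor
  · rintro ⟨a, ha, haS⟩
    obtain rfl : a = u m := eq_of_abs_sub_two_mul_sq_le ha (by simpa using him)
    simpa using haS
  · intro h
    exact ⟨u m, by simpa using him, by simpa using h⟩

/-- Every point of a Cantor space is fixed by some self-homeomorphism having a point along whose
forward orbit every point is a cluster point. -/
theorem exists_homeomorph_fixed_mapClusterPt {C : Type*} [TopologicalSpace C]
    (e : C ≃ₜ (ℕ → Bool)) (l : C) :
    ∃ (σ : C ≃ₜ C) (z : C), σ l = l ∧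
      ∀ y, MapClusterPt y atTop (fun n : ℕ => σ^[n] z) := by
  let d : ℕ ≃ ℤ := (Denumerable.eqv ℤ).symm
  let h : C ≃ₜ (ℤ → Bool) := e.trans (Homeomorph.piCongrLeft (Y := fun _ => Bool) d)
  let t : (ℤ → Bool) ≃ₜ (ℤ → Bool) :=
    { toFun := fun s i => xor (s i) (h l i)
      invFun := fun s i => xor (s i) (h l i)
      left_inv := fun s => by ext i; simp
      right_inv := fun s => by ext i; simp
      continuous_toFun := continuous_pi fun i =>
        (continuous_of_discreteTopology (f := fun b => xor b (h l i))).comp (continuous_apply i)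
      continuous_invFun := continuous_pi fun i =>
        (continuous_of_discreteTopology (f := fun b => xor b (h l i))).comp (continuous_apply i) }
  let s : (ℤ → Bool) ≃ₜ (ℤ → Bool) :=
    { toFun := fun w i => w (i + 1)
      invFun := fun w i => w (i - 1)
      left_inv := fun w => by ext i; simp
      right_inv := fun w => by ext i; simp
      continuous_toFun := by fun_prop
      continuous_invFun := by fun_prop }
  let H : C ≃ₜ (ℤ → Bool) := h.trans t
  obtain ⟨z, hz⟩ := exists_forall_mapClusterPt_shift_s13
  have hs : ∀ (n : ℕ) w, s^[n] w = fun i => w (i + n) := fun n w => by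
    induction n with
    | zero => simp
    | succ n ih =>
      rw [Function.iterate_succ_apply', ih]
      ext i
      change w (i + 1 + n) = w (i + (n + 1 : ℕ))
      congr 1
      push_cast
      ring
  have hHl : H l = fun _ => false := by ext i; simp [H, t]
  refine ⟨(H.trans s).trans H.symm, H.symm z, ?_, fun y => ?_⟩
  · change H.symm (s (H l)) = l
    rw [H.symm_apply_eq, hHl]
    rfl
  · have hconj : ∀ n : ℕ, ((H.trans s).trans H.symm)^[n] (H.symm z) =
        H.symm (fun i => z (i + n)) := fun n => by
      rw [← hs]
      have : Function.Semiconj H.symm s ((H.trans s).trans H.symm) := fun w => by simp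
      exact ((this.iterate_right n).eq z).symm
    simp only [hconj]
    have := (hz (H y)).continuousAt_comp (H.symm.continuous.continuousAt)
    simpa [Function.comp_def] using this

section AdjoinSequence

variable {Y : Type*}

/-- The parametrisation of `K ∪ {x m}` by the disjoint union of `K` and a convergent sequence. -/
def adjoinSeqMap (K : Set Y) (x : ℕ → Y) (L : K) : K ⊕ OnePoint ℕ → ↥(K ∪ range x) :=
  Sum.elim (fun k => ⟨k, Or.inl k.2⟩)
    (fun n => n.elim ⟨L, Or.inl L.2⟩ (fun m => ⟨x m, Or.inr ⟨m, rfl⟩⟩))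

theorem continuous_adjoinSeqMap [TopologicalSpace Y] {K : Set Y} {x : ℕ → Y} {L : K}
    (hlim : Tendsto x atTop (𝓝 (L : Y))) : Continuous (adjoinSeqMap K x L) := by
  refine Continuous.sumElim (by fun_prop) ?_
  rw [OnePoint.continuous_iff_from_nat]
  exact tendsto_subtype_rng.2 hlim

theorem surjective_adjoinSeqMap (K : Set Y) (x : ℕ → Y) (L : K) :
    Function.Surjective (adjoinSeqMap K x L) := by
  rintro ⟨y, hy | ⟨m, rfl⟩⟩
  · exact ⟨Sum.inl ⟨y, hy⟩, rfl⟩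
  · exact ⟨Sum.inr (m : OnePoint ℕ), rfl⟩

theorem compactSpace_union_range [TopologicalSpace Y] {K : Set Y} [CompactSpace K]
    {x : ℕ → Y} {L : K}
    (hlim : Tendsto x atTop (𝓝 (L : Y))) : CompactSpace ↥(K ∪ range x) :=
  Function.Surjective.compactSpace (continuous_adjoinSeqMap hlim)
    (surjective_adjoinSeqMap K x L)

/-- A self-homeomorphism of `K` fixing the limit of `x` extends to a continuous injection of
`K ∪ {x m}` moving `x m` to `x (m + 1)`. -/
theorem exists_continuous_injective_extension [TopologicalSpace Y] [T2Space Y]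
    {K : Set Y} [CompactSpace K]
    {x : ℕ → Y} {L : K} (hinj : Function.Injective x) (hxK : ∀ m, x m ∉ K)
    (hlim : Tendsto x atTop (𝓝 (L : Y))) (σ : K ≃ₜ K) (hσ : σ L = L) :
    ∃ ψ : ↥(K ∪ range x) → ↥(K ∪ range x), Continuous ψ ∧ Function.Injective ψ ∧
      range ψ = {⟨x 0, Or.inr ⟨0, rfl⟩⟩}ᶜ ∧
      (∀ k : K, ψ ⟨k, Or.inl k.2⟩ = ⟨σ k, Or.inl (σ k).2⟩) ∧
      ∀ m, ψ ⟨x m, Or.inr ⟨m, rfl⟩⟩ = ⟨x (m + 1), Or.inr ⟨m + 1, rfl⟩⟩ := by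
  classical
  have hcov : ∀ y : ↥(K ∪ range x), (∃ k : K, y = ⟨k, Or.inl k.2⟩) ∨
      ∃ m, y = ⟨x m, Or.inr ⟨m, rfl⟩⟩ := by
    rintro ⟨y, hy | ⟨m, rfl⟩⟩
    exacts [Or.inl ⟨⟨y, hy⟩, rfl⟩, Or.inr ⟨m, rfl⟩]
  have hne : ∀ (k : K) (m : ℕ), (k : Y) ≠ x m := fun k m h => hxK m (h ▸ k.2)
  let ψ : ↥(K ∪ range x) → ↥(K ∪ range x) := fun y =>
    if h : (y : Y) ∈ K then ⟨σ ⟨y, h⟩, Or.inl (σ ⟨y, h⟩).2⟩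
    else ⟨x (Function.invFun x y + 1), Or.inr ⟨_, rfl⟩⟩
  have hψK : ∀ k : K, ψ ⟨k, Or.inl k.2⟩ = ⟨σ k, Or.inl (σ k).2⟩ := fun k => by simp [ψ]
  have hψx : ∀ m, ψ ⟨x m, Or.inr ⟨m, rfl⟩⟩ = ⟨x (m + 1), Or.inr ⟨m + 1, rfl⟩⟩ := fun m => by
    simp [ψ, hxK, Function.leftInverse_invFun hinj m]
  refine ⟨ψ, ?_, ?_, ?_, hψK, hψx⟩
  · have hq := Topology.IsQuotientMap.of_surjective_continuous
      (surjective_adjoinSeqMap K x L) (continuous_adjoinSeqMap hlim)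
    have hψj : ψ ∘ adjoinSeqMap K x L = Sum.elim (fun k => ⟨σ k, Or.inl (σ k).2⟩)
        (fun n => n.elim ⟨L, Or.inl L.2⟩ (fun m => ⟨x (m + 1), Or.inr ⟨m + 1, rfl⟩⟩)) := by
      funext w
      rcases w with k | n
      · exact hψK k
      · induction n using OnePoint.rec with
        | infty => exact (hψK L).trans (Subtype.ext (by rw [hσ]; rfl))
        | coe m => exact hψx m
    rw [hq.continuous_iff, hψj]
    refine Continuous.sumElim (by fun_prop) ?_
    rw [OnePoint.continuous_iff_from_nat]
    exact tendsto_subtype_rng.2 (hlim.comp (tendsto_add_atTop_nat 1))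
  · intro y y' h
    rcases hcov y with ⟨k, rfl⟩ | ⟨m, rfl⟩ <;> rcases hcov y' with ⟨k', rfl⟩ | ⟨m', rfl⟩ <;>
      simp only [hψK, hψx] at h <;> replace h := congrArg Subtype.val h
    · rw [σ.injective (Subtype.ext h)]
    · exact absurd h (hne _ _)
    · exact absurd h.symm (hne _ _)
    · obtain rfl : m = m' := Nat.succ_injective (hinj h)
      rfl
  · ext y
    rw [mem_compl_singleton_iff]
    constructor
    · rintro ⟨w, rfl⟩
      rcases hcov w with ⟨k, rfl⟩ | ⟨m, rfl⟩ <;>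
        simp only [hψK, hψx] <;> intro h <;> replace h := congrArg Subtype.val h
      · exact hne _ _ h
      · exact Nat.succ_ne_zero m (hinj h)
    · intro h
      rcases hcov y with ⟨k, rfl⟩ | ⟨_ | m, rfl⟩
      · exact ⟨⟨σ.symm k, Or.inl (σ.symm k).2⟩, by rw [hψK]; simp⟩
      · exact absurd rfl h
      · exact ⟨_, hψx m⟩

end AdjoinSequence

/-- Sequence adjoined to a Cantor set in `ℝ`, converging to a point of it: `C(X;𝕂)`
admits an isometric shift of type I with weight `a ≡ 1` which is not of type II. -/
theorem stmt13 (K : Set ℝ) (hK : Nonempty (K ≃ₜ (ℕ → Bool))) (L : ℝ) (hL : L ∈ K)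
    (x : ℕ → ℝ) (hinj : Function.Injective x) (hxK : ∀ m, x m ∉ K)
    (hlim : Filter.Tendsto x Filter.atTop (nhds L)) :
    ∃ _ : CompactSpace ↥(K ∪ Set.range x : Set ℝ),
      ∀ (𝕂 : Type) [RCLike 𝕂],
        ∃ (T : C(↥(K ∪ Set.range x : Set ℝ), 𝕂) →L[𝕂] C(↥(K ∪ Set.range x : Set ℝ), 𝕂))
          (w : TypeIWitness T),
          IsIsometricShift T ∧ (∀ z, w.a z = 1) ∧ ¬IsTypeII T := by
  obtain ⟨e⟩ := hK
  have hcK : CompactSpace K := e.symm.compactSpace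
  have hcX : CompactSpace ↥(K ∪ range x) := compactSpace_union_range (L := ⟨L, hL⟩) hlim
  refine ⟨hcX, fun 𝕂 _ => ?_⟩
  obtain ⟨σ, z, hσ, hz⟩ := exists_homeomorph_fixed_mapClusterPt e ⟨L, hL⟩
  obtain ⟨ψ, hψ, hψinj, hψr, hψK, hψx⟩ :=
    exists_continuous_injective_extension hinj hxK hlim σ hσ
  obtain ⟨q, hq, hqp⟩ := exists_homeomorph_sum_unit hψ hψinj hψr
  let ι : K → ↥(K ∪ range x) := fun k => ⟨k, Or.inl k.2⟩
  have hι : Continuous ι := by fun_prop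
  have hitK : ∀ n, ψ^[n] (ι z) = ι (σ^[n] z) := fun n =>
    ((Function.Semiconj.iterate_right (f := ι) (fun k => (hψK k).symm) n).eq z).symm
  have hitx : ∀ n, ψ^[n] (q (Sum.inr ())) = ⟨x n, Or.inr ⟨n, rfl⟩⟩ := fun n => by
    induction n with
    | zero => exact hqp
    | succ n ih => rw [Function.iterate_succ_apply', ih, hψx]
  refine ⟨halfWeightShift 𝕂 q (ι z), halfWeightShiftWitness q (ι z) 𝕂,
    isIsometricShift_halfWeightShift q (ι z) hq (A := range ι) (L := ι ⟨L, hL⟩)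
      (mem_range_self _) (mem_range_self _) ?_ ?_ ?_ ?_, fun _ => rfl,
    not_isTypeII_halfWeightShift q (ι z)⟩
  · rintro _ ⟨k, rfl⟩
    exact ⟨σ k, (hψK k).symm⟩
  · simp only [hitx]
    exact tendsto_subtype_rng.2 hlim
  · rintro _ ⟨k, rfl⟩
    simp only [hitK]
    exact (hz k).continuousAt_comp hι.continuousAt
  · rintro ⟨y, hy | ⟨m, rfl⟩⟩
    · exact Or.inl ⟨⟨y, hy⟩, rfl⟩
    · exact Or.inr ⟨m, hitx m⟩
end
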